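/- Assume all influences are non-negative, p_t is a price, and Z ∪ W ∪ O is an admissible partition at p_t. Let W₁ ⊆ W and w ∈ W ∖ W₁, and set W₂ = W₁ ∪ {w}. Suppose ρ(L_{W₁×W₁}) < 1 and ρ(L_{W₂×W₂}) ≥ 1. Define u ∈ ℝ^n by u_{W₁} = (I − L_{W₁×W₁})^{-1} L_{W₁×{w}}, where L_{W₁×{w}} is the column vector (L_{i,w})_{i∈W₁}, by u_w = 1, and by u_i = 0 for every i ∉ W₂. Let k be an index attaining the minimum of (1 − q^t_i)/u_i over all i with u_i ≠ 0. Then for every ε > 0, [q̲(p_t − ε)]_k = 1. -/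

import Mathlib

open Filter Topology

/-- med{0,1,x} = max(0, min(1, x)). -/
noncomputable def med (x : ℝ) : ℝ := max 0 (min 1 x)

/-- The transfer function `f_p` of the pricing game. -/
noncomputable def transfer {ι : Type*} [Fintype ι] (a b : ι → ℝ)
    (T : Matrix ι ι ℝ) (p : ℝ) (q : ι → ℝ) : ι → ℝ :=
  fun i => med ((b i - p + ∑ j, T j i * q j) / (b i - a i))

/-- The spectral radius of a real square matrix: the maximum modulus of its
complex eigenvalues. -/
noncomputable def specRad {m : Type*} [Fintype m] [DecidableEq m]
    (M : Matrix m m ℝ) : ℝ :=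
  sSup ((fun z : ℂ => ‖z‖) '' spectrum ℂ (M.map Complex.ofReal))

/-- In a complex Banach algebra, the powers of an element of spectral radius less than one tend
to zero. -/
theorem tendsto_pow_zero_of_spectralRadius_lt_one {A : Type*} [NormedRing A] [NormedAlgebra ℂ A]
    [CompleteSpace A] {x : A} (hx : spectralRadius ℂ x < 1) :
    Tendsto (fun m : ℕ => x ^ m) atTop (𝓝 0) := by
  obtain ⟨r, hxr, hr⟩ := ENNReal.lt_iff_exists_nnreal_btwn.mp hx
  have hr1 : r < 1 := by exact_mod_cast hr
  refine squeeze_zero_norm' ?_ (tendsto_pow_atTop_nhds_zero_of_lt_one r.coe_nonneg hr1)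
  filter_upwards [(spectrum.gelfand_formula x).eventually_lt_const hxr, eventually_gt_atTop 0]
    with m hm hm0
  have hm0' : (m : ℝ) ≠ 0 := by positivity
  have h : (‖x ^ m‖₊ : ENNReal) ≤ (r : ENNReal) ^ m := by
    have h := ENNReal.rpow_le_rpow hm.le (Nat.cast_nonneg (α := ℝ) m)
    rwa [← ENNReal.rpow_mul, one_div_mul_cancel hm0', ENNReal.rpow_one,
      ENNReal.rpow_natCast] at h
  exact_mod_cast h

section Perron

variable {m : Type*} [Fintype m] [DecidableEq m]

open scoped Matrix.Norms.Operator in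
theorem spectralRadius_map_ofReal_lt_one [Nonempty m] {A : Matrix m m ℝ} (hA : specRad A < 1) :
    spectralRadius ℂ (A.map Complex.ofReal) < 1 := by
  refine spectrum.spectralRadius_lt_of_forall_lt (r := 1) _ fun z hz => ?_
  have h : ‖z‖ ≤ specRad A :=
    le_csSup ((Matrix.finite_spectrum _).image _).bddAbove (Set.mem_image_of_mem _ hz)
  exact_mod_cast h.trans_lt hA

open scoped Matrix.Norms.Operator in
theorem tendsto_pow_apply_zero_of_specRad_lt_one {A : Matrix m m ℝ} (hA : specRad A < 1)
    (i j : m) : Tendsto (fun N : ℕ => (A ^ N) i j) atTop (𝓝 0) := by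
  have : Nonempty m := ⟨i⟩
  have h := tendsto_pow_zero_of_spectralRadius_lt_one (A := Matrix m m ℂ)
    (spectralRadius_map_ofReal_lt_one hA)
  have hij : Tendsto (fun N : ℕ => (A.map Complex.ofReal ^ N) i j) atTop (𝓝 0) :=
    ((continuous_id.matrix_elem i j).tendsto 0).comp h
  have hre := (Complex.continuous_re.tendsto 0).comp hij
  refine hre.congr fun N => ?_
  have hmap : A.map Complex.ofReal ^ N = (A ^ N).map Complex.ofReal :=
    (map_pow Complex.ofRealHom.mapMatrix A N).symm
  simp [hmap]

/-- A vector which a non-negative matrix of spectral radius less than one does not decrease is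
non-positive. -/
theorem nonpos_of_le_mulVec {A : Matrix m m ℝ} (hA0 : ∀ i j, 0 ≤ A i j) (hA : specRad A < 1)
    {v : m → ℝ} (hv : v ≤ A.mulVec v) : v ≤ 0 := by
  have hmono : ∀ N : ℕ, v ≤ (A ^ N).mulVec v := by
    intro N
    induction N with
    | zero => simp
    | succ N ih =>
      rw [pow_succ', ← Matrix.mulVec_mulVec]
      exact hv.trans fun i => Finset.sum_le_sum fun j _ =>
        mul_le_mul_of_nonneg_left (ih j) (hA0 i j)
  intro i
  have hlim : Tendsto (fun N : ℕ => (A ^ N).mulVec v i) atTop (𝓝 (∑ j, 0 * v j)) :=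
    tendsto_finsetSum _ fun j _ =>
      (tendsto_pow_apply_zero_of_specRad_lt_one hA i j).mul_const (v j)
  simpa using ge_of_tendsto' hlim fun N => hmono N i

theorem exists_nonneg_le_mulVec_of_one_le_specRad {A : Matrix m m ℝ} (hA0 : ∀ i j, 0 ≤ A i j)
    (hA : 1 ≤ specRad A) : ∃ r : m → ℝ, 0 ≤ r ∧ r ≠ 0 ∧ r ≤ A.mulVec r := by
  have hne : ((fun z : ℂ => ‖z‖) '' spectrum ℂ (A.map Complex.ofReal)).Nonempty := by
    by_contra h
    rw [Set.not_nonempty_iff_eq_empty] at h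
    rw [specRad, h, Real.sSup_empty] at hA
    linarith
  obtain ⟨z, hz, hzA⟩ := hne.csSup_mem ((Matrix.finite_spectrum _).image _)
  have hz1 : 1 ≤ ‖z‖ := hA.trans_eq hzA.symm
  rw [← Matrix.spectrum_toLin', ← Module.End.hasEigenvalue_iff_mem_spectrum] at hz
  obtain ⟨v, hv⟩ := hz.exists_hasEigenvector
  refine ⟨fun i => ‖v i‖, fun i => norm_nonneg _, fun h => hv.2 ?_, fun i => ?_⟩
  · ext i
    exact norm_eq_zero.mp (congrFun h i)
  · have hi : ∑ j, (A i j : ℂ) * v j = z * v i := by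
      simpa [Matrix.mulVec, dotProduct] using congrFun hv.apply_eq_smul i
    calc ‖v i‖ ≤ ‖z‖ * ‖v i‖ := le_mul_of_one_le_left (norm_nonneg _) hz1
      _ = ‖∑ j, (A i j : ℂ) * v j‖ := by rw [hi, norm_mul]
      _ ≤ ∑ j, ‖(A i j : ℂ) * v j‖ := norm_sum_le _ _
      _ = ∑ j, A i j * ‖v j‖ := Finset.sum_congr rfl fun j _ => by
        rw [norm_mul, Complex.norm_real, Real.norm_of_nonneg (hA0 i j)]

end Perron

section Submatrix

variable {ι : Type*} [DecidableEq ι] {L : Matrix ι ι ℝ} {s : Finset ι}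

theorem nonpos_of_le_sum_of_specRad_lt_one (hL : ∀ i j, 0 ≤ L i j)
    (hs : specRad (L.submatrix ((↑) : s → ι) (↑)) < 1) {v : ι → ℝ}
    (hv : ∀ i ∈ s, v i ≤ ∑ j ∈ s, L i j * v j) : ∀ i ∈ s, v i ≤ 0 := by
  intro i hi
  refine nonpos_of_le_mulVec (v := fun j : s => v j) (fun _ _ => hL _ _) hs (fun j => ?_) ⟨i, hi⟩
  simpa only [Matrix.mulVec, dotProduct, Matrix.submatrix_apply,
    Finset.sum_coe_sort s fun l => L j l * v l] using hv j j.2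

/-- If adjoining `w` to `s` pushes the spectral radius to at least one, then the
quasi-eigenvector `u` satisfies `u w ≤ (L u) w`. -/
theorem le_sum_insert_of_one_le_specRad (hL : ∀ i j, 0 ≤ L i j)
    (hs : specRad (L.submatrix ((↑) : s → ι) (↑)) < 1) {w : ι} (hw : w ∉ s)
    (hsw : 1 ≤ specRad (L.submatrix ((↑) : ↥(insert w s) → ι) (↑))) {u : ι → ℝ}
    (hu : ∀ i ∈ s, u i = ∑ j ∈ insert w s, L i j * u j) (huw : u w = 1) :
    u w ≤ ∑ j ∈ insert w s, L w j * u j := by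
  obtain ⟨r', hr0', hrne, hr'⟩ := exists_nonneg_le_mulVec_of_one_le_specRad 
    (A := L.submatrix ((↑) : ↥(insert w s) → ι) (↑)) (fun _ _ => hL _ _) hsw
  obtain ⟨r, hr⟩ : ∃ r : ι → ℝ, ∀ i : ↥(insert w s), r' i = r i :=
    ⟨fun i => if h : i ∈ insert w s then r' ⟨i, h⟩ else 0, fun i => by simp⟩
  have hr0 : ∀ i ∈ insert w s, 0 ≤ r i := fun i hi => (hr0' ⟨i, hi⟩).trans_eq (hr ⟨i, hi⟩)
  have hrL : ∀ i ∈ insert w s, r i ≤ ∑ j ∈ insert w s, L i j * r j := fun i hi => by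
    have h := hr' ⟨i, hi⟩
    rw [hr] at h
    simpa only [Matrix.mulVec, dotProduct, hr, Matrix.submatrix_apply,
      Finset.sum_coe_sort (insert w s) fun l => L i l * r l] using h
  have hle : ∀ i ∈ s, r i - r w * u i ≤ 0 := by
    refine nonpos_of_le_sum_of_specRad_lt_one (v := fun i => r i - r w * u i) hL hs fun i hi => ?_
    have h := hrL i (Finset.mem_insert_of_mem hi)
    have hui := hu i hi
    rw [Finset.sum_insert hw] at h hui
    rw [huw] at hui
    simp only [mul_sub, Finset.sum_sub_distrib, mul_left_comm _ (r w), ← Finset.mul_sum]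
    rw [hui]
    linarith
  have hle' : ∀ i ∈ insert w s, r i ≤ r w * u i := by
    intro i hi
    rcases Finset.mem_insert.mp hi with rfl | hi
    · rw [huw, mul_one]
    · linarith [hle i hi]
  have hwmem := Finset.mem_insert_self w s
  have hrw : 0 < r w := by
    refine (hr0 w hwmem).lt_of_ne fun h => hrne (funext fun i => ?_)
    have hi := hle' i i.2
    rw [← h, zero_mul] at hi
    exact (hr i).trans (le_antisymm hi (hr0 i i.2))
  have hfin : r w ≤ r w * ∑ j ∈ insert w s, L w j * u j := by
    rw [Finset.mul_sum]
    refine (hrL w hwmem).trans (Finset.sum_le_sum fun j hj => ?_)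
    rw [mul_left_comm]
    exact mul_le_mul_of_nonneg_left (hle' j hj) (hL w j)
  rw [huw]
  exact le_of_mul_le_mul_left (by rwa [mul_one]) hrw

end Submatrix

section Transfer

variable {ι : Type*} [Fintype ι] {a b : ι → ℝ} {T : Matrix ι ι ℝ}

theorem med_mono : Monotone med := fun _ _ h => max_le_max le_rfl (min_le_min le_rfl h)

theorem med_le_one (x : ℝ) : med x ≤ 1 := max_le zero_le_one (min_le_left _ _)

theorem le_med_of_lt_one {x : ℝ} (h : med x < 1) : x ≤ med x := by
  unfold med at *
  grind

theorem continuous_transfer (p : ℝ) : Continuous (transfer a b T p) := by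
  unfold transfer med
  fun_prop

theorem transfer_le_transfer (hab : ∀ i, a i < b i) (hT : ∀ i j, 0 ≤ T j i) {p p' : ℝ}
    (hp : p' ≤ p) {q q' : ι → ℝ} (hq : q ≤ q') : transfer a b T p q ≤ transfer a b T p' q' := by
  intro i
  refine med_mono (div_le_div_of_nonneg_right ?_ (sub_nonneg.mpr (hab i).le))
  have := Finset.sum_le_sum fun j (_ : j ∈ Finset.univ) =>
    mul_le_mul_of_nonneg_left (hq j) (hT i j)
  linarith

theorem iterate_transfer_le (hab : ∀ i, a i < b i) (hT : ∀ i j, 0 ≤ T j i) {p p' : ℝ}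
    (hp : p' ≤ p) (q : ι → ℝ) (N : ℕ) :
    (transfer a b T p)^[N] q ≤ (transfer a b T p')^[N] q := by
  induction N with
  | zero => exact le_rfl
  | succ N ih =>
    rw [Function.iterate_succ_apply', Function.iterate_succ_apply']
    exact transfer_le_transfer hab hT hp ih

end Transfer

/-- Let `u ≥ 0` satisfy `u ≤ L u` on its support. A vector `d ≥ 0` which satisfies `L d < d`
wherever it lies below `c * u` on that support dominates `c * u`. -/
theorem mul_le_of_lt_imp_mulVec_lt {ι : Type*} [Fintype ι] {L : Matrix ι ι ℝ}
    (hL : ∀ i j, 0 ≤ L i j) {u d : ι → ℝ} {c : ℝ} (hu0 : 0 ≤ u) (hd0 : 0 ≤ d)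
    (hu : ∀ i, u i ≠ 0 → u i ≤ L.mulVec u i)
    (hd : ∀ i, u i ≠ 0 → d i < c * u i → L.mulVec d i < d i) (i : ι) : c * u i ≤ d i := by
  classical
  by_cases hi : u i = 0
  · simpa [hi] using hd0 i
  obtain ⟨j, hj, hmin⟩ := (Finset.univ.filter fun l => u l ≠ 0).exists_min_image
    (fun l => d l / u l) ⟨i, by simpa using hi⟩
  simp only [Finset.mem_filter, Finset.mem_univ, true_and] at hj hmin
  have hpos : ∀ l, u l ≠ 0 → 0 < u l := fun l hl => (hu0 l).lt_of_ne' hl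
  set σ := d j / u j with hσ
  have hdj : d j = σ * u j := by rw [hσ, div_mul_cancel₀ _ hj]
  have hσ0 : 0 ≤ σ := div_nonneg (hd0 j) (hu0 j)
  have hdom : ∀ l, σ * u l ≤ d l := fun l => by
    by_cases hl : u l = 0
    · simpa [hl] using hd0 l
    · exact (le_div_iff₀ (hpos l hl)).mp (hmin l hl)
  by_contra! hlt
  have hσc : σ < c := (hmin i hi).trans_lt ((div_lt_iff₀ (hpos i hi)).mpr hlt)
  have h := hd j hj (hdj.trans_lt (mul_lt_mul_of_pos_right hσc (hpos j hj)))
  refine absurd h (not_lt.mpr ?_)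
  calc d j = σ * u j := hdj
    _ ≤ σ * L.mulVec u j := mul_le_mul_of_nonneg_left (hu j hj) hσ0
    _ = ∑ l, L j l * (σ * u l) := by
      simp only [Matrix.mulVec, dotProduct, Finset.mul_sum, mul_left_comm]
    _ ≤ L.mulVec d j := Finset.sum_le_sum fun l _ => mul_le_mul_of_nonneg_left (hdom l) (hL j l)

/-- existence of a pivot, quasi-eigenvector version: with
non-negative influences, given an admissible partition `Z ∪ W ∪ O` at price
`p_t`, sets `W₁ ⊆ W` and `W₂ = W₁ ∪ {w}` with `w ∈ W ∖ W₁`,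
`ρ(L_{W₁×W₁}) < 1` and `ρ(L_{W₂×W₂}) ≥ 1`, the quasi-eigenvector `u` defined
by `u_{W₁} = (I − L_{W₁×W₁})⁻¹ L_{W₁×{w}}`, `u_w = 1`, `u = 0` off `W₂`, and
`k` minimizing `(1 − q^t_i)/u_i` over indices with `u_i ≠ 0`, the pessimistic
equilibrium at any lower price `p_t − ε` has `k`-th coordinate equal to `1`. -/
theorem pivot_of_quasi_eigenvector (n : ℕ) (a b : Fin n → ℝ)
    (T : Matrix (Fin n) (Fin n) ℝ)
    (ha : ∀ i, 0 ≤ a i) (hab : ∀ i, a i < b i)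
    (hTdiag : ∀ i, T i i = 0) (hTnn : ∀ i j, 0 ≤ T j i)
    (L : Matrix (Fin n) (Fin n) ℝ) (hL : ∀ i j, L i j = T j i / (b i - a i))
    (pt : ℝ) (qt : Fin n → ℝ)
    -- q^t = q̲(p_t), the pessimistic equilibrium at price p_t
    (hqt : ∀ i, Tendsto (fun m : ℕ => (transfer a b T pt)^[m] (fun _ => 0) i)
      atTop (𝓝 (qt i)))
    (x y : Fin n → ℝ)
    (hx : ∀ i, x i = (b i - pt) / (b i - a i))
    (hy : ∀ i, y i = 1 / (b i - a i))
    -- admissible partition at p_t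
    (Z W O : Finset (Fin n))
    (hZW : Disjoint Z W) (hZO : Disjoint Z O) (hWO : Disjoint W O)
    (hunion : Z ∪ W ∪ O = Finset.univ)
    (hZ : ∀ i ∈ Z, qt i = 0 ∧ (x + L.mulVec qt) i < 0)
    (hW : ∀ i ∈ W, qt i = (x + L.mulVec qt) i ∧ 0 ≤ qt i ∧ qt i < 1)
    (hO : ∀ i ∈ O, qt i = 1 ∧ 1 ≤ (x + L.mulVec qt) i)
    -- the sets W₁ and W₂ = W₁ ∪ {w}
    (W₁ : Finset (Fin n)) (hW₁ : W₁ ⊆ W)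
    (w : Fin n) (hw : w ∈ W) (hwW₁ : w ∉ W₁)
    (W₂ : Finset (Fin n)) (hW₂ : W₂ = insert w W₁)
    (Lw₁ : Matrix {i // i ∈ W₁} {i // i ∈ W₁} ℝ)
    (hLw₁ : ∀ i j, Lw₁ i j = L i.1 j.1)
    (Lw₂ : Matrix {i // i ∈ W₂} {i // i ∈ W₂} ℝ)
    (hLw₂ : ∀ i j, Lw₂ i j = L i.1 j.1)
    (hρ₁ : specRad Lw₁ < 1) (hρ₂ : 1 ≤ specRad Lw₂)
    -- the quasi-eigenvector u
    (u : Fin n → ℝ)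
    (huW₁ : ∀ i (h : i ∈ W₁),
      u i = (1 - Lw₁)⁻¹.mulVec (fun j => L j.1 w) ⟨i, h⟩)
    (huw : u w = 1)
    (husupp : ∀ i, i ∉ W₂ → u i = 0)
    -- the pivot
    (k : Fin n) (hk : u k ≠ 0)
    (hkmin : ∀ i, u i ≠ 0 → (1 - qt k) / u k ≤ (1 - qt i) / u i) :
    ∀ ε > (0:ℝ), ∀ ql : Fin n → ℝ,
      (∀ i, Tendsto (fun m : ℕ => (transfer a b T (pt - ε))^[m] (fun _ => 0) i)
        atTop (𝓝 (ql i))) →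
      ql k = 1 := by
  intro ε hε ql hql
  obtain rfl : Lw₂ = L.submatrix (↑) (↑) := by ext i j; exact hLw₂ i j
  subst hW₂
  have hba : ∀ i, 0 < b i - a i := fun i => sub_pos.mpr (hab i)
  have hL0 : ∀ i j, 0 ≤ L i j := fun i j => hL i j ▸ div_nonneg (hTnn i j) (hba i).le
  have hLw0 : ∀ i j, 0 ≤ Lw₁ i j := fun i j => hLw₁ i j ▸ hL0 _ _
  have hρ₁' : specRad (L.submatrix ((↑) : {i // i ∈ W₁} → Fin n) (↑)) < 1 := by
    convert hρ₁
    ext i j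
    exact (hLw₁ i j).symm
  have hdet : IsUnit (1 - Lw₁).det := by
    rw [isUnit_iff_ne_zero]
    intro h0
    obtain ⟨v, hv0, hv⟩ := Matrix.exists_mulVec_eq_zero_iff.mpr h0
    rw [Matrix.sub_mulVec, Matrix.one_mulVec, sub_eq_zero] at hv
    have h1 := nonpos_of_le_mulVec hLw0 hρ₁ hv.le
    have h2 := nonpos_of_le_mulVec (v := -v) hLw0 hρ₁
      (by rw [Matrix.mulVec_neg, ← hv])
    exact hv0 (le_antisymm h1 (neg_nonpos.mp h2))
  have hu₁ : ∀ i ∈ W₁, u i = ∑ j ∈ insert w W₁, L i j * u j := by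
    intro i hi
    have huv : (fun j : {i // i ∈ W₁} => u j) = (1 - Lw₁)⁻¹.mulVec
        (fun j => L j.1 w) := funext fun j => huW₁ j j.2
    have h := congrArg (1 - Lw₁).mulVec huv
    rw [Matrix.mulVec_mulVec, Matrix.mul_nonsing_inv _ hdet, Matrix.one_mulVec,
      Matrix.sub_mulVec, Matrix.one_mulVec] at h
    have hi' := congrFun h ⟨i, hi⟩
    simp only [Pi.sub_apply, Matrix.mulVec, dotProduct, hLw₁,
      Finset.sum_coe_sort W₁ fun l => L i l * u l] at hi'
    rw [Finset.sum_insert hwW₁, huw]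
    linarith
  have hu0 : 0 ≤ u := by
    have h := nonpos_of_le_sum_of_specRad_lt_one (v := fun i => -u i) hL0 hρ₁' fun i hi => by
      have hi' := hu₁ i hi
      rw [Finset.sum_insert hwW₁, huw] at hi'
      simp only [mul_neg, Finset.sum_neg_distrib]
      linarith [hL0 i w]
    intro i
    by_cases hi : i ∈ W₁
    · exact neg_nonpos.mp (h i hi)
    by_cases hiw : i = w
    · rw [hiw, huw]
      exact zero_le_one
    · exact (husupp i (by simp [hi, hiw])).ge
  have hsupp : ∀ i, u i ≠ 0 → i ∈ insert w W₁ := fun i hi => by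
    by_contra h
    exact hi (husupp i h)
  have hLu : ∀ i, ∑ j ∈ insert w W₁, L i j * u j = L.mulVec u i := fun i =>
    Finset.sum_subset (Finset.subset_univ _) fun j _ hj => by rw [husupp j hj, mul_zero]
  have hu : ∀ i, u i ≠ 0 → u i ≤ L.mulVec u i := by
    intro i hi
    rw [← hLu]
    rcases Finset.mem_insert.mp (hsupp i hi) with rfl | h
    · exact le_sum_insert_of_one_le_specRad hL0 hρ₁' hwW₁ hρ₂ hu₁ huw
    · exact (hu₁ i h).le
  have hfix : transfer a b T (pt - ε) ql = ql :=
    isFixedPt_of_tendsto_iterate (tendsto_pi_nhds.mpr hql)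
      (continuous_transfer (pt - ε)).continuousAt
  have hd0 : 0 ≤ ql - qt := fun i => sub_nonneg.mpr <|
    le_of_tendsto_of_tendsto' (hqt i) (hql i) fun N =>
      iterate_transfer_le hab hTnn (by linarith) _ N i
  have hql1 : ∀ i, ql i ≤ 1 := fun i => by
    rw [← hfix]
    exact med_le_one _
  have hgrow : ∀ i ∈ W, ql i < 1 → L.mulVec (ql - qt) i < (ql - qt) i := by
    intro i hi hlt
    have hle : (b i - (pt - ε) + ∑ j, T j i * ql j) / (b i - a i) ≤ ql i := by
      rw [← congrFun hfix i] at hlt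
      exact (le_med_of_lt_one hlt).trans_eq (congrFun hfix i)
    have hsum : (b i - (pt - ε) + ∑ j, T j i * ql j) / (b i - a i)
        = x i + ε / (b i - a i) + L.mulVec ql i := by
      have hLq : L.mulVec ql i = (∑ j, T j i * ql j) / (b i - a i) := by
        simp only [Matrix.mulVec, dotProduct, hL, Finset.sum_div, div_mul_eq_mul_div]
      rw [hLq, hx]
      ring
    have hqi := (hW i hi).1
    have hεi : 0 < ε / (b i - a i) := div_pos hε (hba i)
    rw [hsum] at hle
    simp only [Matrix.mulVec_sub, Pi.sub_apply, Pi.add_apply] at hqi ⊢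
    linarith
  have hpos : ∀ i, u i ≠ 0 → 0 < u i := fun i hi => (hu0 i).lt_of_ne' hi
  have hmain := mul_le_of_lt_imp_mulVec_lt (c := (1 - qt k) / u k) hL0 hu0 hd0 hu
    (fun i hi hlt => hgrow i (Finset.insert_subset hw hW₁ (hsupp i hi)) <| by
      have h := (le_div_iff₀ (hpos i hi)).mp (hkmin i hi)
      rw [Pi.sub_apply] at hlt
      linarith) k
  rw [div_mul_cancel₀ _ hk, Pi.sub_apply] at hmain
  exact le_antisymm (hql1 k) (by linarith)
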